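/- (Compactness for simultaneous limits) Let d ≥ 2, let {r_n} ⊂ (0,1) with r_n → 0⁺ and {s_n} ⊂ (1,+∞) with s_n → 1⁺. Let U ⊂ ℝ^d be an open bounded set and let {E_n} be measurable subsets of U such that J̃_{r_n}^{s_n}(E_n) ≤ M·β(r_n, s_n) for every n, for some constant M independent of n. Then, up to a subsequence, χ_{E_n} → χ_E strongly in L¹(ℝ^d) for some measurable set E ⊆ ℝ^d of finite Lebesgue measure and finite perimeter. -/

import Mathlib

open MeasureTheory Filter Set Metric
open scoped ENNReal NNReal symmDiff

noncomputable section

abbrev Euc (d : ℕ) : Type := EuclideanSpace ℝ (Fin d)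

/-- The kernel `k^s_r`. -/
def ker (d : ℕ) (s r t : ℝ) : ℝ :=
  if t ≤ r then r ^ (-((d : ℝ) + s)) else t ^ (-((d : ℝ) + s))

/-- The regularized `s`-fractional perimeter `J̃_r^s(E) = ∫_E ∫_{Eᶜ} k^s_r(|x-y|) dy dx`. -/
def Jt (d : ℕ) (s r : ℝ) (E : Set (Euc d)) : ℝ≥0∞ :=
  ∫⁻ x in E, ∫⁻ y in Eᶜ, ENNReal.ofReal (ker d s r (dist x y))

/-- The scaling factor `σ^s(r)`. -/
def sgm (d : ℕ) (s r : ℝ) : ℝ :=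
  if s = 1 then |Real.log r| else (((d : ℝ) + s) / ((d : ℝ) + 1)) * r ^ (1 - s) / (s - 1)

/-- The scaling factor `β(r,s)` for the simultaneous limit. -/
def betaScale (d : ℕ) (s r : ℝ) : ℝ :=
  (((d : ℝ) + s) / ((d : ℝ) + 1)) * ((r ^ (1 - s) - 1) / (s - 1)) + 1 / ((d : ℝ) + 1)

/-- `ω_k`: Lebesgue measure of the unit ball in `ℝ^k`. -/
def omegaB (k : ℕ) : ℝ := (volume (ball (0 : Euc k) 1)).toReal

/-- Divergence of a vector field on `ℝ^d`. -/
def diverg {d : ℕ} (Φ : Euc d → Euc d) (x : Euc d) : ℝ :=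
  ∑ i : Fin d, fderiv ℝ Φ x (EuclideanSpace.single i 1) i

/-- De Giorgi perimeter. -/
def Per (d : ℕ) (E : Set (Euc d)) : ℝ≥0∞ :=
  ⨆ (Φ : Euc d → Euc d) (_ : ContDiff ℝ 1 Φ) (_ : HasCompactSupport Φ)
    (_ : ∀ x, ‖Φ x‖ ≤ 1), ENNReal.ofReal (∫ x in E, diverg Φ x)

/-- The cube `lQ + ξ` where `Q = [-1/2, 1/2)^d`. -/
def cube (d : ℕ) (l : ℝ) (ξ : Euc d) : Set (Euc d) :=
  {x | ∀ i, x i ∈ Set.Ico (ξ i - l / 2) (ξ i + l / 2)}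

/-- Half space `H⁻_ν(0)`. -/
def Hminus (d : ℕ) (ν : Euc d) : Set (Euc d) := {y | @inner ℝ _ _ ν y ≤ 0}

/-- Standard (normalized) `k`-dimensional Hausdorff measure on `ℝ^d`:
Mathlib's `μH[k]` uses `diam^k` gauges without the normalizing constant `ω_k/2^k`. -/
def Hstd (d : ℕ) (k : ℕ) : Measure (Euc d) :=
  (ENNReal.ofReal (omegaB k / 2 ^ k)) • (μH[(k : ℝ)] : Measure (Euc d))

/-- The nonlocal `k^s_r`-curvature. -/
def curv (d : ℕ) (s r : ℝ) (E : Set (Euc d)) (x : Euc d) : ℝ :=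
  ∫ y, (Set.indicator Eᶜ (fun _ => (1 : ℝ)) y - Set.indicator E (fun _ => (1 : ℝ)) y)
    * ker d s r (dist x y)

/-- The class `𝔈`: closures of open sets with compact `C²` boundary. -/
def IsC2Domain (d : ℕ) (E : Set (Euc d)) : Prop :=
  ∃ U : Set (Euc d), IsOpen U ∧ E = closure U ∧ IsCompact (frontier U) ∧
    ∃ f : Euc d → ℝ, ContDiff ℝ 2 f ∧ U = {x | f x < 0} ∧ frontier U = {x | f x = 0} ∧
      ∀ x ∈ frontier U, fderiv ℝ f x ≠ 0


def gg {d : ℕ} (E : Set (Euc d)) (h : Euc d) : ℝ≥0∞ := volume (E \ ((fun x => x + h) ⁻¹' E))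

lemma gg_add {d : ℕ} (E : Set (Euc d)) (h k : Euc d) : gg E (h + k) ≤ gg E h + gg E k := by
  unfold gg
  calc volume (E \ ((fun x => x + (h + k)) ⁻¹' E))
      ≤ volume ((E \ ((fun x => x + h) ⁻¹' E)) ∪
          ((fun x => x + h) ⁻¹' (E \ ((fun x => x + k) ⁻¹' E)))) := by
        apply measure_mono
        intro x hx
        simp only [Set.mem_sdiff, mem_preimage, mem_union] at hx ⊢
        by_cases h1 : x + h ∈ E
        · right; exact ⟨h1, by rw [add_assoc]; exact hx.2⟩
        · left; exact ⟨hx.1, h1⟩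
    _ ≤ _ := measure_union_le _ _
    _ = _ := by rw [measure_preimage_add_right]

lemma gg_zero {d : ℕ} (E : Set (Euc d)) : gg E 0 = 0 := by simp [gg]

lemma gg_nsmul {d : ℕ} (E : Set (Euc d)) (h : Euc d) (n : ℕ) : gg E (n • h) ≤ n * gg E h := by
  induction n with
  | zero => simp [gg_zero]
  | succ n ih =>
    rw [succ_nsmul]
    refine (gg_add _ _ _).trans ?_
    push_cast
    rw [add_mul, one_mul]
    gcongr

lemma gg_symm {d : ℕ} {E : Set (Euc d)} (hE : MeasurableSet E) (h : Euc d) :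
    volume (E ∆ ((fun x => x + h) ⁻¹' E)) = gg E h + gg E (-h) := by
  have hp : MeasurableSet ((fun x => x + h) ⁻¹' E) := (measurable_add_const h) hE
  rw [measure_symmDiff_eq hE.nullMeasurableSet hp.nullMeasurableSet]
  unfold gg
  congr 1
  rw [← measure_preimage_add_right volume h (E \ ((fun x => x + -h) ⁻¹' E))]
  congr 1
  ext x
  simp

lemma gg_eq_lintegral {d : ℕ} {E : Set (Euc d)} (hE : MeasurableSet E) (h : Euc d) :
    gg E h = ∫⁻ x, E.indicator 1 x * (Eᶜ).indicator 1 (x + h) := by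
  have hp : MeasurableSet ((fun x => x + h) ⁻¹' E) := (measurable_add_const h) hE
  unfold gg
  rw [← lintegral_indicator_one (hE.diff hp)]
  congr 1
  ext x
  by_cases h1 : x ∈ E <;> by_cases h2 : x + h ∈ E <;> simp [h1, h2]

lemma meas_joint {d : ℕ} {E : Set (Euc d)} (hE : MeasurableSet E) :
    Measurable (fun p : Euc d × Euc d =>
      (E.indicator 1 p.2 * (Eᶜ).indicator 1 (p.2 + p.1) : ℝ≥0∞)) := by
  have h1 : Measurable (E.indicator (1 : Euc d → ℝ≥0∞)) := measurable_one.indicator hE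
  have h2 : Measurable (Eᶜ.indicator (1 : Euc d → ℝ≥0∞)) := measurable_one.indicator hE.compl
  fun_prop

lemma gg_meas {d : ℕ} {E : Set (Euc d)} (hE : MeasurableSet E) : Measurable (gg E) := by
  have : gg E = fun h => ∫⁻ x, E.indicator 1 x * (Eᶜ).indicator 1 (x + h) := by
    ext h; exact gg_eq_lintegral hE h
  rw [this]
  exact (meas_joint hE).lintegral_prod_right'

lemma ker_meas (d : ℕ) (s r : ℝ) : Measurable (fun t => ker d s r t) := by
  unfold _root_.ker
  apply Measurable.ite (measurableSet_le measurable_id measurable_const) <;> fun_prop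

lemma Jt_eq {d : ℕ} (s r : ℝ) {E : Set (Euc d)} (hE : MeasurableSet E) :
    Jt d s r E = ∫⁻ h, gg E h * ENNReal.ofReal (ker d s r ‖h‖) := by
  have hk := ker_meas d s r
  have h1 : Measurable (E.indicator (1 : Euc d → ℝ≥0∞)) := measurable_one.indicator hE
  have h2 : Measurable (Eᶜ.indicator (1 : Euc d → ℝ≥0∞)) := measurable_one.indicator hE.compl
  have hk' : Measurable (fun h : Euc d => ENNReal.ofReal (ker d s r ‖h‖)) := by
    exact (hk.comp measurable_norm).ennreal_ofReal
  calc Jt d s r E = ∫⁻ x, ∫⁻ h, (E.indicator 1 x * (Eᶜ).indicator 1 (x + h))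
        * ENNReal.ofReal (ker d s r ‖h‖) := by
        unfold Jt
        rw [← lintegral_indicator hE]
        congr 1
        ext x
        by_cases hx : x ∈ E
        · simp only [hx, indicator_of_mem, Pi.one_apply, one_mul]
          rw [← lintegral_indicator hE.compl]
          rw [← lintegral_add_left_eq_self _ x]
          congr 1
          ext h
          by_cases hy : x + h ∈ E <;> simp [hy, dist_eq_norm]
        · simp [hx]
    _ = ∫⁻ h, ∫⁻ x, (E.indicator 1 x * (Eᶜ).indicator 1 (x + h))
        * ENNReal.ofReal (ker d s r ‖h‖) := by
        rw [lintegral_lintegral_swap]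
        apply Measurable.aemeasurable
        unfold Function.uncurry
        fun_prop
    _ = _ := by
        congr 1
        ext h
        rw [gg_eq_lintegral hE, lintegral_mul_const]
        fun_prop

def AA {d : ℕ} (E : Set (Euc d)) (t : ℝ) : ℝ≥0∞ := ∫⁻ h in {h : Euc d | t / 2 < ‖h‖ ∧ ‖h‖ ≤ t}, gg E h

lemma ker_inner (d : ℕ) {s r : ℝ} (hr : 0 < r) (hs : 1 < s) (a δ : ℝ) (ha : 0 ≤ a) :
    ∫⁻ t in Ioo r δ, (Ico a (2 * a)).indicator (fun t => ENNReal.ofReal (t ^ (-((d : ℝ) + s) - 1))) t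
      ≤ ENNReal.ofReal (ker d s r a) := by
  rcases ha.eq_or_lt with rfl | ha
  · simp
  have hds : -((d : ℝ) + s) ≤ 0 := by have : (0 : ℝ) ≤ d := by positivity
                                      linarith
  calc _ ≤ ∫⁻ t in Ioo r δ, (Ico a (2 * a)).indicator (fun t => ENNReal.ofReal (ker d s r a * a⁻¹)) t := by
        apply setLIntegral_mono' measurableSet_Ioo
        intro t ht
        apply indicator_le_indicator' 
        intro hta
        apply ENNReal.ofReal_le_ofReal
        have ht0 : 0 < t := ha.trans_le hta.1
        rw [Real.rpow_sub ht0, Real.rpow_one, div_eq_mul_inv]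
        have : t ^ (-((d : ℝ) + s)) ≤ ker d s r a := by
          unfold _root_.ker
          split_ifs
          · exact Real.rpow_le_rpow_of_nonpos hr ht.1.le hds
          · exact Real.rpow_le_rpow_of_nonpos ha hta.1 hds
        have h0 : 0 < t ^ (-((d : ℝ) + s)) := by positivity
        have := hta.1
        gcongr
        linarith
    _ ≤ ∫⁻ t, (Ico a (2 * a)).indicator (fun t => ENNReal.ofReal (ker d s r a * a⁻¹)) t :=
        setLIntegral_le_lintegral _ _
    _ = ENNReal.ofReal (ker d s r a * a⁻¹) * ENNReal.ofReal a := by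
        rw [lintegral_indicator measurableSet_Ico]
        simp [two_mul]
    _ = _ := by
        rw [← ENNReal.ofReal_mul' ha.le]
        congr 1
        field_simp

lemma Jt_lower {d : ℕ} {s r : ℝ} (hr : 0 < r) (hs : 1 < s) (δ : ℝ) {E : Set (Euc d)}
    (hE : MeasurableSet E) :
    ∫⁻ t in Ioo r δ, ENNReal.ofReal (t ^ (-((d : ℝ) + s) - 1)) * AA E t ≤ Jt d s r E := by
  have hg := gg_meas hE
  let S : Set (ℝ × Euc d) := {p | ‖p.2‖ ≤ p.1} ∩ {p | p.1 < 2 * ‖p.2‖}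
  have hS : MeasurableSet S :=
    (measurableSet_le (f := fun p : ℝ × Euc d => ‖p.2‖) (g := fun p => p.1)
      (by fun_prop) (by fun_prop)).inter
    (measurableSet_lt (f := fun p : ℝ × Euc d => p.1) (g := fun p => 2 * ‖p.2‖)
      (by fun_prop) (by fun_prop))
  let K : ℝ × Euc d → ℝ≥0∞ :=
    S.indicator (fun p => ENNReal.ofReal (p.1 ^ (-((d : ℝ) + s) - 1)) * gg E p.2)
  have hm : Measurable K := by
    apply Measurable.indicator _ hS
    fun_prop
  have e1 : ∫⁻ t in Ioo r δ, ENNReal.ofReal (t ^ (-((d : ℝ) + s) - 1)) * AA E t =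
      ∫⁻ t in Ioo r δ, ∫⁻ h, K (t, h) := by
    congr 1
    ext t
    unfold AA
    have hA : MeasurableSet {h : Euc d | t / 2 < ‖h‖ ∧ ‖h‖ ≤ t} :=
      (measurableSet_lt (f := fun h : Euc d => t / 2) (g := fun h => ‖h‖)
        (by fun_prop) (by fun_prop)).inter
      (measurableSet_le (f := fun h : Euc d => ‖h‖) (g := fun h => t)
        (by fun_prop) (by fun_prop))
    rw [← lintegral_const_mul _ hg, ← lintegral_indicator hA]
    congr 1
    ext h
    by_cases h1 : t / 2 < ‖h‖ ∧ ‖h‖ ≤ t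
    · have h2 : ‖h‖ ≤ t ∧ t < 2 * ‖h‖ := ⟨h1.2, by linarith [h1.1]⟩
      simp [K, S, indicator, h1, h2]
    · have h2 : ¬ (‖h‖ ≤ t ∧ t < 2 * ‖h‖) := fun h2 => h1 ⟨by linarith [h2.2], h2.1⟩
      simp [K, S, indicator, h1, h2]
  rw [Jt_eq s r hE, e1, lintegral_lintegral_swap (f := fun t h => K (t, h)) hm.aemeasurable]
  apply lintegral_mono
  intro h
  have := ker_inner d hr hs ‖h‖ δ (norm_nonneg h)
  refine le_trans (le_of_eq ?_) (mul_le_mul_right this (gg E h))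
  rw [← lintegral_const_mul]
  · apply lintegral_congr
    intro t
    by_cases h1 : ‖h‖ ≤ t ∧ t < 2 * ‖h‖
    · simp [K, S, indicator, h1, mul_comm]
    · simp [K, S, indicator, h1]
  · apply Measurable.indicator _ measurableSet_Ico
    fun_prop

lemma pigeon {d : ℕ} {s r δ K : ℝ} (hr : 0 < r) (hrδ : r < δ) (hs : 1 < s) (hK : 0 ≤ K)
    {E : Set (Euc d)} (hE : MeasurableSet E)
    (hJ : Jt d s r E < ENNReal.ofReal (K * ((r ^ (1 - s) - δ ^ (1 - s)) / (s - 1)))) :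
    ∃ t ∈ Ioo r δ, AA E t ≤ ENNReal.ofReal (K * t ^ (d + 1)) := by
  by_contra! hcon
  refine absurd ((Jt_lower hr hs δ hE).trans_lt hJ) (not_lt.2 ?_)
  have hint : IntervalIntegrable (fun t : ℝ => t ^ (-s)) volume r δ := by
    apply intervalIntegral.intervalIntegrable_rpow
    right
    rw [uIcc_of_le hrδ.le]
    intro h; linarith [h.1]
  have hI : ∫ t in r..δ, t ^ (-s) = (r ^ (1 - s) - δ ^ (1 - s)) / (s - 1) := by
    rw [integral_rpow]
    · rw [show -s + 1 = 1 - s by ring]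
      rw [div_eq_div_iff (by linarith) (by linarith)]
      ring
    · right
      refine ⟨by linarith, ?_⟩
      rw [uIcc_of_le hrδ.le]
      intro h; linarith [h.1]
  rw [← hI, ← intervalIntegral.integral_const_mul, intervalIntegral.integral_of_le hrδ.le,
    integral_Ioc_eq_integral_Ioo, ofReal_integral_eq_lintegral_ofReal]
  · apply setLIntegral_mono' measurableSet_Ioo
    intro t ht
    have ht0 : 0 < t := hr.trans ht.1
    refine le_trans (le_of_eq ?_) (mul_le_mul_right (hcon t ht).le _)
    rw [← ENNReal.ofReal_mul (by positivity)]
    congr 1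
    rw [← Real.rpow_natCast t (d + 1)]
    rw [mul_left_comm, ← Real.rpow_add ht0]
    congr 2
    push_cast
    ring
  · exact ((hint.const_mul K).1).mono_set Ioo_subset_Ioc_self
  · apply ae_restrict_of_forall_mem measurableSet_Ioo
    intro t ht
    have ht0 : 0 < t := hr.trans ht.1
    simp only [Pi.zero_apply]
    positivity

lemma gg_small {d : ℕ} (hd : 2 ≤ d) {t K : ℝ} (ht : 0 < t) (hK : 0 ≤ K)
    {E : Set (Euc d)} (hE : MeasurableSet E)
    (hA : AA E t ≤ ENNReal.ofReal (K * t ^ (d + 1))) (h : Euc d) (hh : ‖h‖ ≤ t / 8) :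
    gg E h ≤ ENNReal.ofReal (2 * K / (volume (ball (0 : Euc d) (1 / 8))).toReal * t) := by
  have hg := gg_meas hE
  set v := (volume (ball (0 : Euc d) (1 / 8))).toReal with hv
  have hv0 : 0 < v := ENNReal.toReal_pos (measure_ball_pos _ _ (by norm_num)).ne' measure_ball_lt_top.ne
  let c : Euc d := EuclideanSpace.single ⟨0, by omega⟩ (3 * t / 4)
  have hc : ‖c‖ = 3 * t / 4 := by
    simp only [c, PiLp.norm_single, Real.norm_eq_abs]
    exact abs_of_pos (by positivity)
  let A : Set (Euc d) := {h : Euc d | t / 2 < ‖h‖ ∧ ‖h‖ ≤ t}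
  have hAm : MeasurableSet A :=
      (measurableSet_lt (f := fun h : Euc d => t / 2) (g := fun h => ‖h‖)
        (by fun_prop) (by fun_prop)).inter
      (measurableSet_le (f := fun h : Euc d => ‖h‖) (g := fun h => t)
        (by fun_prop) (by fun_prop))
  have hB : ∀ x ∈ ball c (t / 8), x ∈ A ∧ h - x ∈ A := by
    intro x hx
    rw [mem_ball, dist_eq_norm] at hx
    have h1 : ‖x‖ ≤ ‖c‖ + ‖x - c‖ := by
      calc ‖x‖ = ‖c + (x - c)‖ := by congr 1; abel
        _ ≤ _ := norm_add_le _ _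
    have h2 : ‖c‖ ≤ ‖x‖ + ‖x - c‖ := by
      calc ‖c‖ = ‖x - (x - c)‖ := by congr 1; abel
        _ ≤ _ := norm_sub_le _ _
    have h3 : ‖h - x‖ ≤ ‖h‖ + ‖x‖ := norm_sub_le _ _
    have h4 : ‖x‖ ≤ ‖h‖ + ‖h - x‖ := by
      calc ‖x‖ = ‖h - (h - x)‖ := by congr 1; abel
        _ ≤ _ := norm_sub_le _ _
    rw [hc] at h1 h2
    refine ⟨⟨?_, ?_⟩, ⟨?_, ?_⟩⟩ <;> linarith
  have hvB : volume (ball c (t / 8)) = ENNReal.ofReal (t ^ d * v) := by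
    have := Measure.addHaar_ball_mul_of_pos (volume : Measure (Euc d)) c ht (1 / 8)
    rw [show t / 8 = t * (1 / 8) by ring, this, ENNReal.ofReal_mul (by positivity), hv,
      ENNReal.ofReal_toReal measure_ball_lt_top.ne]
    simp
  have key : gg E h * ENNReal.ofReal (t ^ d * v) ≤ ENNReal.ofReal (2 * (K * t ^ (d + 1))) := by
    calc gg E h * ENNReal.ofReal (t ^ d * v) = ∫⁻ x in ball c (t / 8), gg E h := by
          rw [setLIntegral_const, hvB]
      _ ≤ ∫⁻ x in ball c (t / 8), (gg E x + gg E (h - x)) := by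
          apply lintegral_mono
          intro x
          simpa using gg_add E x (h - x)
      _ = (∫⁻ x in ball c (t / 8), gg E x) + ∫⁻ x in ball c (t / 8), gg E (h - x) :=
          lintegral_add_left hg _
      _ ≤ AA E t + AA E t := by
          gcongr
          · apply lintegral_mono_set
            intro x hx
            exact (hB x hx).1
          · unfold AA
            rw [← lintegral_indicator measurableSet_ball, ← lintegral_indicator hAm,
              ← lintegral_sub_left_eq_self (A.indicator (gg E)) h]
            apply lintegral_mono
            intro x
            by_cases hx : x ∈ ball c (t / 8)
            · simp only [indicator_of_mem hx, indicator_of_mem (hB x hx).2]; exact le_rfl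
            · simp only [indicator_of_notMem hx]; exact zero_le
      _ ≤ ENNReal.ofReal (K * t ^ (d + 1)) + ENNReal.ofReal (K * t ^ (d + 1)) := by gcongr
      _ = _ := by rw [← ENNReal.ofReal_add (by positivity) (by positivity), two_mul]
  have hpos : 0 < t ^ d * v := by positivity
  rw [← ENNReal.le_div_iff_mul_le (by left; simpa using hpos) (by left; exact ENNReal.ofReal_ne_top),
    ← ENNReal.ofReal_div_of_pos hpos] at key
  refine key.trans (le_of_eq ?_)
  congr 1
  field_simp
  ring

lemma gg_all {d : ℕ} {t K : ℝ} (ht : 0 < t) (hK : 0 ≤ K) {E : Set (Euc d)}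
    (hs : ∀ h : Euc d, ‖h‖ ≤ t / 8 → gg E h ≤ ENNReal.ofReal (K * t)) (h : Euc d) :
    gg E h ≤ ENNReal.ofReal (8 * K * (‖h‖ + t)) := by
  let n : ℕ := ⌊8 * ‖h‖ / t⌋₊ + 1
  have hn : 8 * ‖h‖ / t < n := by
    simpa [n] using Nat.lt_floor_add_one (8 * ‖h‖ / t)
  have hn' : (n : ℝ) ≤ 8 * ‖h‖ / t + 1 := by
    have := Nat.floor_le (show 0 ≤ 8 * ‖h‖ / t by positivity)
    simp only [n]; push_cast; linarith
  have hn0 : (0 : ℝ) < n := by simp only [n]; positivity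
  have e : h = n • ((n : ℝ)⁻¹ • h) := by
    rw [← Nat.cast_smul_eq_nsmul ℝ, smul_smul, mul_inv_cancel₀ hn0.ne', one_smul]
  have h1 : ‖(n : ℝ)⁻¹ • h‖ ≤ t / 8 := by
    rw [norm_smul, norm_inv, Real.norm_natCast, inv_mul_le_iff₀ hn0]
    rw [div_lt_iff₀ ht] at hn
    linarith
  calc gg E h = gg E (n • ((n : ℝ)⁻¹ • h)) := by rw [← e]
    _ ≤ n * gg E ((n : ℝ)⁻¹ • h) := gg_nsmul _ _ _
    _ ≤ n * ENNReal.ofReal (K * t) := by gcongr; exact hs _ h1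
    _ = ENNReal.ofReal (n * (K * t)) := by
        rw [ENNReal.ofReal_mul hn0.le, ENNReal.ofReal_natCast]
    _ ≤ _ := by
        apply ENNReal.ofReal_le_ofReal
        calc (n : ℝ) * (K * t) ≤ (8 * ‖h‖ / t + 1) * (K * t) := by gcongr
          _ = 8 * K * ‖h‖ + K * t := by field_simp
          _ ≤ _ := by nlinarith [mul_nonneg hK ht.le]

lemma beta_ev (d : ℕ) (r s : ℕ → ℝ) (hr : ∀ n, r n ∈ Set.Ioo (0 : ℝ) 1)
    (hr0 : Tendsto r atTop (nhds 0)) (hs : ∀ n, 1 < s n) (hs1 : Tendsto s atTop (nhds 1))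
    (M δ : ℝ) (hδ : 0 < δ) :
    ∀ᶠ n in atTop, r n < δ ∧ 0 < (2 * |M| + 1) * (((r n) ^ (1 - s n) - δ ^ (1 - s n)) / (s n - 1)) ∧
      M * betaScale d (s n) (r n) <
      (2 * |M| + 1) * (((r n) ^ (1 - s n) - δ ^ (1 - s n)) / (s n - 1)) := by
  have hlog : Tendsto (fun n => - Real.log (r n)) atTop atTop := by
    apply tendsto_neg_atBot_atTop.comp
    apply Real.tendsto_log_nhdsGT_zero.comp
    rw [tendsto_nhdsWithin_iff]
    exact ⟨hr0, Eventually.of_forall fun n => (hr n).1⟩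
  filter_upwards [hr0.eventually_lt_const hδ, hs1.eventually_lt_const (show (1 : ℝ) < 2 by norm_num),
    hlog.eventually_gt_atTop ((2 * |M| + 1) * δ⁻¹ + |M|)] with n h1 h2 h3
  refine ⟨h1, ?_⟩
  have ha : 0 < s n - 1 := by linarith [hs n]
  set a := s n - 1 with hadef
  have hr1 := (hr n).1
  set X := ((r n) ^ (1 - s n) - 1) / a with hX
  set Y := (δ ^ (1 - s n) - 1) / a with hY
  have hXlog : - Real.log (r n) ≤ X := by
    rw [hX, le_div_iff₀ ha, Real.rpow_def_of_pos hr1]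
    have := Real.add_one_le_exp (Real.log (r n) * (1 - s n))
    have e : 1 - s n = - a := by rw [hadef]; ring
    rw [e] at this ⊢
    linarith
  have hYle : Y ≤ δ⁻¹ := by
    rw [hY, div_le_iff₀ ha]
    have e : δ ^ (1 - s n) = (1 + (δ⁻¹ - 1)) ^ a := by
      rw [show 1 + (δ⁻¹ - 1) = δ⁻¹ by ring, Real.inv_rpow hδ.le, ← Real.rpow_neg hδ.le]
      congr 1; rw [hadef]; ring
    have hi : 0 < δ⁻¹ := by positivity
    have := rpow_one_add_le_one_add_mul_self (s := δ⁻¹ - 1) (by linarith) ha.le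
      (by rw [hadef]; linarith)
    rw [e]
    nlinarith
  have e : ((r n) ^ (1 - s n) - δ ^ (1 - s n)) / a = X - Y := by
    rw [hX, hY]; ring
  have hd0 : (0 : ℝ) ≤ d := by positivity
  have hM := abs_nonneg M
  have hX0 : 0 ≤ X := by
    have : 0 < δ⁻¹ := by positivity
    have : 0 ≤ (2 * |M| + 1) * δ⁻¹ := by positivity
    linarith
  have hb : betaScale d (s n) (r n) ≤ 2 * X + 1 := by
    unfold betaScale
    have b1 : ((d : ℝ) + s n) / (d + 1) ≤ 2 := by
      rw [div_le_iff₀ (by positivity)]; linarith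
    have b2 : 1 / ((d : ℝ) + 1) ≤ 1 := by
      rw [div_le_iff₀ (by positivity)]; linarith
    have : ((d : ℝ) + s n) / (d + 1) * X ≤ 2 * X := by gcongr
    linarith
  have hb0 : 0 ≤ betaScale d (s n) (r n) := by
    unfold betaScale
    have b1 : 0 ≤ ((d : ℝ) + s n) / (d + 1) := by
      have := hs n
      positivity
    have b2 : 0 ≤ 1 / ((d : ℝ) + 1) := by positivity
    have := mul_nonneg b1 hX0
    linarith
  rw [e]
  have hfin : |M| * (2 * X + 1) < (2 * |M| + 1) * (X - Y) := by
    have : (2 * |M| + 1) * Y ≤ (2 * |M| + 1) * δ⁻¹ := by gcongr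
    nlinarith
  refine ⟨lt_of_le_of_lt (by positivity) hfin, lt_of_le_of_lt ?_ hfin⟩
  exact mul_le_mul (le_abs_self M) hb hb0 hM

lemma main_est (d : ℕ) (hd : 2 ≤ d) (r s : ℕ → ℝ) (hr : ∀ n, r n ∈ Set.Ioo (0 : ℝ) 1)
    (hr0 : Tendsto r atTop (nhds 0)) (hs : ∀ n, 1 < s n) (hs1 : Tendsto s atTop (nhds 1))
    (E : ℕ → Set (Euc d)) (hEmeas : ∀ n, MeasurableSet (E n)) (M : ℝ)
    (hM : ∀ n, Jt d (s n) (r n) (E n) ≤ ENNReal.ofReal (M * betaScale d (s n) (r n))) :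
    ∃ C : ℝ, 0 ≤ C ∧ ∀ δ > 0, ∀ᶠ n in atTop, ∀ h, gg (E n) h ≤ ENNReal.ofReal (C * (‖h‖ + δ)) := by
  set K := 2 * |M| + 1 with hK
  have hK0 : 0 < K := by positivity
  set v := (volume (ball (0 : Euc d) (1 / 8))).toReal with hv
  have hv0 : 0 ≤ v := ENNReal.toReal_nonneg
  refine ⟨8 * (2 * K / v), by positivity, ?_⟩
  intro δ hδ
  filter_upwards [beta_ev d r s hr hr0 hs hs1 M δ hδ] with n hn h
  have hlt : Jt d (s n) (r n) (E n) < _ :=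
    (hM n).trans_lt ((ENNReal.ofReal_lt_ofReal_iff hn.2.1).2 hn.2.2)
  · obtain ⟨t, ht, hA⟩ := pigeon (hr n).1 hn.1 (hs n) hK0.le (hEmeas n) hlt
    have ht0 : 0 < t := (hr n).1.trans ht.1
    refine (gg_all ht0 (by positivity) (gg_small hd ht0 hK0.le (hEmeas n) hA) h).trans ?_
    apply ENNReal.ofReal_le_ofReal
    have : t ≤ δ := ht.2.le
    gcongr

lemma ind_int {d : ℕ} {F : Set (Euc d)} (hF : MeasurableSet F) (hFv : volume F < ⊤) :
    Integrable (F.indicator (1 : Euc d → ℝ)) volume :=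
  (integrable_indicator_iff hF).2 (integrableOn_const hFv.ne : IntegrableOn (fun _ => (1 : ℝ)) F volume)

lemma per_dir {d : ℕ} {F : Set (Euc d)} (hF : MeasurableSet F) (hFv : volume F < ⊤) {C : ℝ}
    (hC : 0 ≤ C) (hg : ∀ h, gg F h ≤ ENNReal.ofReal (C * ‖h‖)) (f : Euc d → ℝ)
    {L : ℝ≥0} (hf : LipschitzWith L f) (hfb : ∀ x, |f x| ≤ 1) (v : Euc d) (hv : ‖v‖ = 1) :
    ∫ x in F, lineDeriv ℝ f x v ≤ 2 * C := by
  have hi : Integrable (F.indicator (1 : Euc d → ℝ)) volume :=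
    ind_int hF hFv
  have hT := hf.integral_inv_smul_sub_mul_tendsto_integral_lineDeriv_mul hi v
  have e : ∫ x in F, lineDeriv ℝ f x v = ∫ x, lineDeriv ℝ f x v * F.indicator 1 x := by
    rw [← integral_indicator hF]
    congr 1
    ext x
    by_cases hx : x ∈ F <;> simp [hx]
  rw [e]
  refine le_of_tendsto hT ?_
  filter_upwards [self_mem_nhdsWithin] with t ht
  have ht : 0 < t := ht
  have hmul : ∀ w : Euc d, Integrable (fun x => f (x + w) * F.indicator (1 : Euc d → ℝ) x) volume := by
    intro w
    apply hi.bdd_mul (c := 1)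
    · exact (hf.continuous.comp (continuous_add_const w)).aestronglyMeasurable
    · exact Eventually.of_forall fun x => hfb _
  have hi' : Integrable (fun x => F.indicator (1 : Euc d → ℝ) (x + -(t • v))) volume :=
    hi.comp_add_right _
  have h0 : Integrable (fun x => f x * F.indicator (1 : Euc d → ℝ) x) volume := by
    simpa using hmul 0
  have h1 : Integrable (fun x => f x * F.indicator (1 : Euc d → ℝ) (x + -(t • v))) volume := by
    apply hi'.bdd_mul (c := 1)
    · exact hf.continuous.aestronglyMeasurable
    · exact Eventually.of_forall fun x => hfb _
  have e1 : ∫ x, (t⁻¹ • (f (x + t • v) - f x)) * F.indicator 1 x =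
      t⁻¹ * ∫ x, f x * (F.indicator (1 : Euc d → ℝ) (x + -(t • v)) - F.indicator 1 x) := by
    have : ∫ x, f (x + t • v) * F.indicator (1 : Euc d → ℝ) x =
        ∫ x, f x * F.indicator (1 : Euc d → ℝ) (x + -(t • v)) := by
      have := integral_add_right_eq_self (μ := volume)
        (fun x => f x * F.indicator (1 : Euc d → ℝ) (x + -(t • v))) (t • v)
      rw [← this]
      simp only [add_neg_cancel_right]
    simp_rw [smul_eq_mul, mul_assoc]
    rw [integral_const_mul]
    congr 1
    simp_rw [sub_mul, mul_sub]
    rw [integral_sub (hmul (t • v)) h0, integral_sub h1 h0, this]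
  set S := F ∆ ((fun x => x + -(t • v)) ⁻¹' F) with hS
  have hSm : MeasurableSet S := hF.symmDiff ((measurable_add_const _) hF)
  have hSv : volume S ≤ ENNReal.ofReal (2 * C * t) := by
    rw [hS, gg_symm hF]
    refine (add_le_add (hg _) (hg _)).trans ?_
    rw [← ENNReal.ofReal_add (by positivity) (by positivity)]
    apply ENNReal.ofReal_le_ofReal
    simp only [norm_neg, norm_smul, hv, Real.norm_eq_abs, abs_of_pos ht]
    linarith
  have hSi : Integrable (S.indicator (1 : Euc d → ℝ)) volume :=
    ind_int hSm (hSv.trans_lt ENNReal.ofReal_lt_top)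
  rw [e1, inv_mul_le_iff₀ ht]
  calc _ ≤ ∫ x, S.indicator (1 : Euc d → ℝ) x := by
        apply integral_mono
        · simp_rw [mul_sub]; exact h1.sub h0
        · exact hSi
        · intro x
          have hb := abs_le.1 (hfb x)
          by_cases a1 : x ∈ F <;> by_cases a2 : x + -(t • v) ∈ F <;>
            simp [S, indicator, mem_symmDiff, a1, a2] <;> linarith
    _ = volume.real S := by rw [integral_indicator_one hSm]
    _ ≤ _ := by
        rw [mul_comm]
        exact ENNReal.toReal_le_of_le_ofReal (by positivity) hSv

lemma per_finite {d : ℕ} {F : Set (Euc d)} (hF : MeasurableSet F) (hFv : volume F < ⊤) {C : ℝ}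
    (hC : 0 ≤ C) (hg : ∀ h, gg F h ≤ ENNReal.ofReal (C * ‖h‖)) : Per d F < ⊤ := by
  refine lt_of_le_of_lt (b := ENNReal.ofReal (d * (2 * C))) ?_ ENNReal.ofReal_lt_top
  unfold Per
  refine iSup_le fun Φ => iSup_le fun hΦ => iSup_le fun hcs => iSup_le fun hb => ?_
  apply ENNReal.ofReal_le_ofReal
  have hdiff : Differentiable ℝ Φ := hΦ.differentiable (by simp)
  obtain ⟨L, hL⟩ := ContDiff.lipschitzWith_of_hasCompactSupport hcs hΦ (by simp)
  have hproj : ∀ i : Fin d, LipschitzWith L (fun x => Φ x i) := by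
    intro i
    apply LipschitzWith.of_dist_le_mul
    intro x y
    refine le_trans ?_ (hL.dist_le_mul x y)
    rw [dist_eq_norm, dist_eq_norm]
    exact PiLp.norm_apply_le (Φ x - Φ y) i
  have hld : ∀ (i : Fin d) x, fderiv ℝ Φ x (EuclideanSpace.single i 1) i =
      lineDeriv ℝ (fun x => Φ x i) x (EuclideanSpace.single i 1) := by
    intro i x
    have h1 : HasFDerivAt (fun x => Φ x i)
        ((EuclideanSpace.proj i : Euc d →L[ℝ] ℝ).comp (fderiv ℝ Φ x)) x :=
      (EuclideanSpace.proj i : Euc d →L[ℝ] ℝ).hasFDerivAt.comp x (hdiff x).hasFDerivAt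
    rw [(h1.hasLineDerivAt _).lineDeriv]
    rfl
  unfold diverg
  rw [integral_finsetSum]
  · calc _ ≤ ∑ i : Fin d, 2 * C := by
          apply Finset.sum_le_sum
          intro i _
          simp_rw [hld]
          apply per_dir hF hFv hC hg _ (hproj i)
          · intro x
            exact (PiLp.norm_apply_le (Φ x) i).trans (hb x)
          · simp
      _ = _ := by simp
  · intro i _
    apply Integrable.integrableOn
    have hc : Continuous (fun x => fderiv ℝ Φ x (EuclideanSpace.single i 1) i) := by
      have := hΦ.continuous_fderiv (by simp)
      fun_prop
    apply hc.integrable_of_hasCompactSupport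
    have := hcs.fderiv ℝ
    refine this.mono ?_
    intro x hx
    simp only [Function.mem_support] at hx ⊢
    intro h0
    apply hx
    simp [h0]

lemma complete_sets {d : ℕ} (G : ℕ → Set (Euc d)) (hG : ∀ n, MeasurableSet (G n))
    (hc : ∀ ε : ℝ≥0∞, 0 < ε → ∃ N, ∀ k ≥ N, ∀ l ≥ N, volume (G k ∆ G l) ≤ ε) :
    ∃ ψ : ℕ → ℕ, StrictMono ψ ∧ ∃ F, MeasurableSet F ∧
      Tendsto (fun k => volume (G (ψ k) ∆ F)) atTop (nhds 0) := by
  obtain ⟨ψ, hψ, hp⟩ := extraction_forall_of_eventually'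
    (P := fun n k => ∀ l ≥ k, volume (G k ∆ G l) ≤ (2⁻¹ : ℝ≥0∞) ^ n) (by
      intro n
      obtain ⟨N, hN⟩ := hc ((2⁻¹ : ℝ≥0∞) ^ n) (by
        apply ENNReal.pow_pos; simp)
      exact ⟨N, fun k hk l hl => hN k hk l (hk.trans hl)⟩)
  refine ⟨ψ, hψ, ⋂ n, ⋃ k, G (ψ (n + k)), ?_, ?_⟩
  · exact MeasurableSet.iInter fun n => MeasurableSet.iUnion fun k => hG _
  have hsub : ∀ n, G (ψ n) ∆ (⋂ n, ⋃ k, G (ψ (n + k))) ⊆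
      ⋃ k, G (ψ (n + k)) ∆ G (ψ (n + k + 1)) := by
    intro n x hx
    by_contra hcon
    simp only [mem_iUnion, not_exists, mem_symmDiff, not_or, not_and, not_not] at hcon
    have hk : ∀ k, x ∈ G (ψ (n + k)) ↔ x ∈ G (ψ n) := by
      intro k
      induction k with
      | zero => simp
      | succ k ih =>
        rw [← ih]
        exact ⟨(hcon k).2, (hcon k).1⟩
    have hFx : x ∈ (⋂ n, ⋃ k, G (ψ (n + k))) ↔ x ∈ G (ψ n) := by
      simp only [mem_iInter, mem_iUnion]
      constructor
      · intro h
        obtain ⟨k, h⟩ := h n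
        exact (hk k).1 h
      · intro h m
        exact ⟨n, by rw [add_comm]; exact (hk m).2 h⟩
    rw [mem_symmDiff, hFx] at hx
    tauto
  have hle : ∀ n, volume (G (ψ n) ∆ (⋂ n, ⋃ k, G (ψ (n + k)))) ≤ (2⁻¹ : ℝ≥0∞) ^ n * 2 := by
    intro n
    calc _ ≤ volume (⋃ k, G (ψ (n + k)) ∆ G (ψ (n + k + 1))) := measure_mono (hsub n)
      _ ≤ ∑' k, volume (G (ψ (n + k)) ∆ G (ψ (n + k + 1))) := measure_iUnion_le _
      _ ≤ ∑' k, (2⁻¹ : ℝ≥0∞) ^ n * (2⁻¹ : ℝ≥0∞) ^ k := by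
          apply ENNReal.tsum_le_tsum
          intro k
          rw [← pow_add]
          exact hp (n + k) _ (hψ.monotone (Nat.le_succ _))
      _ = _ := by
          rw [ENNReal.tsum_mul_left, ENNReal.tsum_geometric]
          simp
  refine tendsto_of_tendsto_of_tendsto_of_le_of_le tendsto_const_nhds ?_ (fun _ => zero_le) hle
  have := ENNReal.Tendsto.mul_const (b := 2)
    (ENNReal.tendsto_pow_atTop_nhds_zero_of_lt_one (r := 2⁻¹) (by simp)) (Or.inr (by simp))
  simpa using this

lemma conv_sub {d : ℕ} {U : Set (Euc d)} (hU : volume U < ⊤) (E : ℕ → Set (Euc d))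
    (hE : ∀ n, MeasurableSet (E n)) (hEU : ∀ n, E n ⊆ U) :
    ∃ φ : ℕ → ℕ, StrictMono φ ∧ ∀ A : Set (Euc d), MeasurableSet A →
      ∃ L : ℝ, Tendsto (fun k => volume.real (E (φ k) ∩ A)) atTop (nhds L) := by
  set μ : Measure (Euc d) := volume.restrict U with hμ
  have : IsFiniteMeasure μ := ⟨by simpa [hμ] using hU⟩
  have hEA : ∀ n A, volume.real (E n ∩ A) = μ.real (E n ∩ A) := by
    intro n A
    simp only [Measure.real, hμ]
    rw [Measure.restrict_eq_self]
    exact inter_subset_left.trans (hEU n)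
  obtain ⟨𝒜, hcount, hdense⟩ := exists_countable_measureDense μ
  have : Countable 𝒜 := hcount.to_subtype
  let p : ℕ → (𝒜 → ℝ) := fun n A => μ.real (E n ∩ A)
  have hcpt : IsCompact (Set.pi univ fun _ : 𝒜 => Icc (0 : ℝ) (μ.real univ)) :=
    isCompact_univ_pi fun _ => isCompact_Icc
  obtain ⟨q, -, φ, hφ, hlim⟩ := hcpt.tendsto_subseq (x := p) (by
    intro n A _
    exact ⟨measureReal_nonneg, measureReal_mono (subset_univ _)⟩)
  refine ⟨φ, hφ, ?_⟩
  intro A hA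
  apply cauchySeq_tendsto_of_complete
  rw [Metric.cauchySeq_iff']
  intro ε hε
  obtain ⟨B, hB, hAB⟩ := hdense.approx A hA (measure_ne_top _ _) (ε / 3) (by positivity)
  have hBm := hdense.measurable B hB
  have hABr : μ.real (A ∆ B) < ε / 3 := by
    rw [Measure.real]
    exact ENNReal.toReal_lt_of_lt_ofReal hAB
  have hclose : ∀ n, |μ.real (E n ∩ A) - μ.real (E n ∩ B)| < ε / 3 := by
    intro n
    refine lt_of_le_of_lt ((abs_measureReal_sub_le_measureReal_symmDiff
      ((hE n).inter hA).nullMeasurableSet ((hE n).inter hBm).nullMeasurableSet).trans ?_) hABr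
    refine measureReal_mono ?_ (measure_ne_top _ _)
    rw [← inter_symmDiff_distrib_left]
    exact inter_subset_right
  have hlimB : Tendsto (fun k => μ.real (E (φ k) ∩ B)) atTop (nhds (q ⟨B, hB⟩)) :=
    (tendsto_pi_nhds.1 hlim) ⟨B, hB⟩
  obtain ⟨N, hN⟩ := Metric.cauchySeq_iff'.1 hlimB.cauchySeq (ε / 3) (by positivity)
  refine ⟨N, fun n hn => ?_⟩
  have h1 := hN n hn
  rw [Real.dist_eq] at h1 ⊢
  rw [hEA, hEA]
  have h2 := hclose (φ n)
  have h3 := hclose (φ N)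
  rw [abs_lt] at *
  constructor <;> linarith [h1.1, h1.2, h2.1, h2.2, h3.1, h3.2]

lemma smooth_est {d : ℕ} {E : Set (Euc d)} (hE : MeasurableSet E) (hEv : volume E < ⊤) (η : ℝ) :
    ∫⁻ x, ‖volume.real (ball (0 : Euc d) η) * E.indicator 1 x - volume.real (E ∩ ball x η)‖ₑ ≤
      ∫⁻ h in ball (0 : Euc d) η, (gg E h + gg E (-h)) := by
  have hind : Measurable (E.indicator (1 : Euc d → ℝ)) := measurable_one.indicator hE
  have e1 : ∀ x, volume.real (ball (0 : Euc d) η) * E.indicator 1 x - volume.real (E ∩ ball x η)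
      = ∫ h in ball (0 : Euc d) η, (E.indicator (1 : Euc d → ℝ) x - E.indicator 1 (x + h)) := by
    intro x
    have hm : MeasurableSet ((fun h => x + h) ⁻¹' E) := (measurable_const_add x) hE
    have hi : IntegrableOn (fun h => E.indicator (1 : Euc d → ℝ) (x + h)) (ball 0 η) volume :=
      ((ind_int hE hEv).comp_add_left x).integrableOn
    have hc : IntegrableOn (fun _ : Euc d => E.indicator (1 : Euc d → ℝ) x) (ball 0 η) volume :=
      integrableOn_const measure_ball_lt_top.ne
    rw [integral_sub hc hi, setIntegral_const, smul_eq_mul]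
    congr 1
    have : (fun h => E.indicator (1 : Euc d → ℝ) (x + h)) = ((fun h => x + h) ⁻¹' E).indicator 1 := by
      ext h; by_cases hh : x + h ∈ E <;> simp [hh]
    rw [this, integral_indicator_one hm, measureReal_restrict_apply hm]
    simp only [Measure.real]
    congr 1
    rw [← measure_preimage_add volume x (E ∩ ball x η)]
    congr 1
    ext h
    simp
  calc _ ≤ ∫⁻ x, ∫⁻ h in ball (0 : Euc d) η, ‖E.indicator (1 : Euc d → ℝ) x - E.indicator 1 (x + h)‖ₑ := by
        apply lintegral_mono
        intro x
        simp only [e1]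
        exact enorm_integral_le_lintegral_enorm _
    _ = ∫⁻ h in ball (0 : Euc d) η, ∫⁻ x, ‖E.indicator (1 : Euc d → ℝ) x - E.indicator 1 (x + h)‖ₑ := by
        apply lintegral_lintegral_swap
        apply Measurable.aemeasurable
        unfold Function.uncurry
        fun_prop
    _ = _ := by
        congr 1
        ext h
        have hm : MeasurableSet (E ∆ ((fun x => x + h) ⁻¹' E)) :=
          hE.symmDiff ((measurable_add_const h) hE)
        rw [← gg_symm hE, ← lintegral_indicator_one hm]
        apply lintegral_congr
        intro x
        by_cases a1 : x ∈ E <;> by_cases a2 : x + h ∈ E <;> simp [indicator, mem_symmDiff, a1, a2]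

lemma cauchy_sets {d : ℕ} {R : ℝ} (E : ℕ → Set (Euc d))
    (hE : ∀ n, MeasurableSet (E n)) (hEU : ∀ n, E n ⊆ ball 0 R) {C : ℝ} (hC : 0 ≤ C)
    (hg : ∀ δ > 0, ∀ᶠ n in atTop, ∀ h, gg (E n) h ≤ ENNReal.ofReal (C * (‖h‖ + δ)))
    (hconv : ∀ A : Set (Euc d), MeasurableSet A →
      ∃ L : ℝ, Tendsto (fun k => volume.real (E k ∩ A)) atTop (nhds L))
    (ε : ℝ≥0∞) (hε : 0 < ε) : ∃ N, ∀ k ≥ N, ∀ l ≥ N, volume (E k ∆ E l) ≤ ε := by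
  obtain ⟨ε', hε', hεle⟩ : ∃ ε' : ℝ, 0 < ε' ∧ ENNReal.ofReal ε' ≤ ε := by
    obtain ⟨e, he, he'⟩ := ENNReal.lt_iff_exists_nnreal_btwn.1 hε
    exact ⟨e, by simpa using he, by simpa using he'.le⟩
  set η : ℝ := ε' / (2 * (4 * C + 1)) with hη
  have hη0 : 0 < η := by positivity
  have hEv : ∀ n, volume (E n) < ⊤ := fun n => (measure_mono (hEU n)).trans_lt measure_ball_lt_top
  set b := volume.real (ball (0 : Euc d) η) with hb
  have hb0 : 0 < b := ENNReal.toReal_pos (measure_ball_pos _ _ hη0).ne' measure_ball_lt_top.ne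
  have hbE : volume (ball (0 : Euc d) η) = ENNReal.ofReal b := by
    rw [hb, Measure.real, ENNReal.ofReal_toReal measure_ball_lt_top.ne]
  choose L hL using fun x : Euc d => hconv (ball x η) measurableSet_ball
  have hVm : ∀ n, Measurable (fun x => volume.real (E n ∩ ball x η)) := by
    intro n
    apply Measurable.ennreal_toReal
    have hS : MeasurableSet {p : Euc d × Euc d | p.2 ∈ E n ∧ dist p.2 p.1 < η} :=
      (measurable_snd (hE n)).inter
        (measurableSet_lt (f := fun p : Euc d × Euc d => dist p.2 p.1) (g := fun _ => η)
          (by fun_prop) (by fun_prop))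
    exact measurable_measure_prodMk_left hS
  have hdct : Tendsto (fun n => ∫⁻ x, ENNReal.ofReal ‖volume.real (E n ∩ ball x η) - L x‖) atTop (nhds 0) := by
    apply tendsto_lintegral_norm_of_dominated_convergence
      (bound := (ball (0 : Euc d) (R + η)).indicator (fun _ => b))
    · intro n; exact (hVm n).aestronglyMeasurable
    · exact ((integrable_indicator_iff measurableSet_ball).2
        (integrableOn_const measure_ball_lt_top.ne)).2
    · intro n
      refine Eventually.of_forall fun x => ?_
      rw [Real.norm_of_nonneg measureReal_nonneg]
      by_cases hx : x ∈ ball (0 : Euc d) (R + η)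
      · rw [indicator_of_mem hx, hb]
        simp only [Measure.real]
        apply ENNReal.toReal_mono measure_ball_lt_top.ne
        refine (measure_mono inter_subset_right).trans (le_of_eq ?_)
        exact Measure.addHaar_ball_center _ _ _
      · rw [indicator_of_notMem hx]
        have : E n ∩ ball x η = ∅ := by
          rw [eq_empty_iff_forall_notMem]
          rintro y ⟨hy1, hy2⟩
          apply hx
          have h1 := hEU n hy1
          rw [mem_ball] at *
          rw [dist_comm] at hy2
          linarith [dist_triangle x y 0]
        simp [this]
    · exact Eventually.of_forall hL
  have hev : ∀ᶠ n in atTop, ∫⁻ x, ‖b * (E n).indicator 1 x - L x‖ₑ ≤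
      ENNReal.ofReal (b * ((4 * C + 1) * η)) := by
    filter_upwards [hg η hη0, hdct.eventually_lt_const
      (show (0 : ℝ≥0∞) < ENNReal.ofReal (b * η) by rw [ENNReal.ofReal_pos]; positivity)] with n h1 h2
    calc _ ≤ ∫⁻ x, (‖b * (E n).indicator 1 x - volume.real (E n ∩ ball x η)‖ₑ +
            ENNReal.ofReal ‖volume.real (E n ∩ ball x η) - L x‖) := by
          apply lintegral_mono
          intro x
          simp only [ofReal_norm]
          refine le_trans (le_of_eq ?_) (enorm_add_le _ _)
          congr 1
          ring
      _ = (∫⁻ x, ‖b * (E n).indicator 1 x - volume.real (E n ∩ ball x η)‖ₑ) +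
            ∫⁻ x, ENNReal.ofReal ‖volume.real (E n ∩ ball x η) - L x‖ := by
          apply lintegral_add_left
          have hind : Measurable ((E n).indicator (1 : Euc d → ℝ)) := measurable_one.indicator (hE n)
          have := hVm n
          fun_prop
      _ ≤ ENNReal.ofReal (4 * C * η) * ENNReal.ofReal b + ENNReal.ofReal (b * η) := by
          gcongr
          refine (smooth_est (hE n) (hEv n) η).trans ?_
          rw [← hbE, ← setLIntegral_const]
          apply setLIntegral_mono' measurableSet_ball
          intro h hh
          refine (add_le_add (h1 h) (h1 (-h))).trans ?_
          rw [← ENNReal.ofReal_add (by positivity) (by positivity)]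
          apply ENNReal.ofReal_le_ofReal
          rw [norm_neg]
          rw [mem_ball_zero_iff] at hh
          nlinarith [mul_le_mul_of_nonneg_left hh.le hC]
      _ = _ := by
          rw [← ENNReal.ofReal_mul (by positivity), ← ENNReal.ofReal_add (by positivity) (by positivity)]
          congr 1
          ring
  obtain ⟨N, hN⟩ := eventually_atTop.1 hev
  refine ⟨N, fun k hk l hl => le_trans ?_ hεle⟩
  have hLm : Measurable L := measurable_of_tendsto_metrizable hVm (tendsto_pi_nhds.2 hL)
  have key : volume (E k ∆ E l) * ENNReal.ofReal b ≤ ENNReal.ofReal (b * ε') := by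
    have hm : MeasurableSet (E k ∆ E l) := (hE k).symmDiff (hE l)
    calc volume (E k ∆ E l) * ENNReal.ofReal b
        = ∫⁻ x, (E k ∆ E l).indicator (fun _ => ENNReal.ofReal b) x := by
          rw [lintegral_indicator hm, setLIntegral_const, mul_comm]
      _ ≤ ∫⁻ x, (‖b * (E k).indicator 1 x - L x‖ₑ + ‖b * (E l).indicator 1 x - L x‖ₑ) := by
          apply lintegral_mono
          intro x
          have e : (E k ∆ E l).indicator (fun _ => ENNReal.ofReal b) x =
              ‖(b * (E k).indicator 1 x - L x) - (b * (E l).indicator 1 x - L x)‖ₑ := by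
            rw [sub_sub_sub_cancel_right]
            by_cases a1 : x ∈ E k <;> by_cases a2 : x ∈ E l <;>
              simp [indicator, mem_symmDiff, a1, a2, Real.enorm_eq_ofReal hb0.le]
          simp only [e]
          exact enorm_sub_le
      _ = (∫⁻ x, ‖b * (E k).indicator 1 x - L x‖ₑ) + ∫⁻ x, ‖b * (E l).indicator 1 x - L x‖ₑ := by
          apply lintegral_add_left
          have hind : Measurable ((E k).indicator (1 : Euc d → ℝ)) := measurable_one.indicator (hE k)
          fun_prop
      _ ≤ ENNReal.ofReal (b * ((4 * C + 1) * η)) + ENNReal.ofReal (b * ((4 * C + 1) * η)) :=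
          add_le_add (hN k hk) (hN l hl)
      _ = _ := by
          rw [← ENNReal.ofReal_add (by positivity) (by positivity)]
          congr 1
          rw [hη]
          field_simp
          ring
  rw [mul_comm b ε', ENNReal.ofReal_mul hε'.le] at key
  exact (ENNReal.mul_le_mul_iff_left (by simpa using hb0) ENNReal.ofReal_ne_top).1 key

lemma gg_lim {d : ℕ} (E F : Set (Euc d)) (h : Euc d) :
    gg F h ≤ gg E h + 2 * volume (E ∆ F) := by
  unfold gg
  calc volume (F \ ((fun x => x + h) ⁻¹' F))
      ≤ volume ((E \ ((fun x => x + h) ⁻¹' E)) ∪ (E ∆ F ∪ (fun x => x + h) ⁻¹' (E ∆ F))) := by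
        apply measure_mono
        intro x hx
        simp only [Set.mem_sdiff, mem_preimage, mem_union, mem_symmDiff] at hx ⊢
        tauto
    _ ≤ _ := (measure_union_le _ _).trans (add_le_add le_rfl (measure_union_le _ _))
    _ = _ := by rw [measure_preimage_add_right, two_mul]

/-- **Compactness for simultaneous limits `r_n → 0⁺`, `s_n → 1⁺`.** -/
theorem stmt15 (d : ℕ) (hd : 2 ≤ d)
    (r : ℕ → ℝ) (hr : ∀ n, r n ∈ Set.Ioo (0 : ℝ) 1) (hr0 : Tendsto r atTop (nhds 0))
    (s : ℕ → ℝ) (hs : ∀ n, 1 < s n) (hs1 : Tendsto s atTop (nhds 1))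
    (U : Set (Euc d)) (hUopen : IsOpen U) (hUbdd : Bornology.IsBounded U)
    (E : ℕ → Set (Euc d)) (hEmeas : ∀ n, MeasurableSet (E n)) (hEU : ∀ n, E n ⊆ U)
    (M : ℝ)
    (hM : ∀ n, Jt d (s n) (r n) (E n) ≤ ENNReal.ofReal (M * betaScale d (s n) (r n))) :
    ∃ φ : ℕ → ℕ, StrictMono φ ∧ ∃ F : Set (Euc d), MeasurableSet F ∧
      volume F < ⊤ ∧ Per d F < ⊤ ∧
      Tendsto (fun k => volume ((E (φ k)) ∆ F)) atTop (nhds 0) := by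
  obtain ⟨C, hC, hest⟩ := main_est d hd r s hr hr0 hs hs1 E hEmeas M hM
  obtain ⟨R, hR⟩ := hUbdd.subset_ball (0 : Euc d)
  have hUv : volume U < ⊤ := (measure_mono hR).trans_lt measure_ball_lt_top
  obtain ⟨φ, hφ, hconv⟩ := conv_sub hUv E hEmeas hEU
  obtain ⟨ψ, hψ, F, hF, hlim⟩ := complete_sets (fun k => E (φ k)) (fun k => hEmeas _)
    (cauchy_sets (fun k => E (φ k)) (fun k => hEmeas _) (fun k => (hEU _).trans hR) hC
      (fun δ hδ => hφ.tendsto_atTop.eventually (hest δ hδ)) hconv)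
  have hFv : volume F < ⊤ := by
    obtain ⟨k, hk⟩ := (hlim.eventually_lt_const (show (0 : ℝ≥0∞) < 1 by simp)).exists
    calc volume F ≤ volume (E (φ (ψ k)) ∪ E (φ (ψ k)) ∆ F) := by
          apply measure_mono
          intro x hx
          simp only [mem_union, mem_symmDiff]
          tauto
      _ ≤ volume (E (φ (ψ k))) + volume (E (φ (ψ k)) ∆ F) := measure_union_le _ _
      _ < ⊤ := ENNReal.add_lt_top.2 ⟨(measure_mono (hEU _)).trans_lt hUv, hk.trans (by simp)⟩
  refine ⟨φ ∘ ψ, hφ.comp hψ, F, hF, hFv, per_finite hF hFv hC ?_, hlim⟩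
  intro h
  have h1 : ∀ δ > 0, gg F h ≤ ENNReal.ofReal (C * (‖h‖ + δ)) := by
    intro δ hδ
    have ht : Tendsto (fun k => ENNReal.ofReal (C * (‖h‖ + δ)) + 2 * volume (E (φ (ψ k)) ∆ F)) atTop
        (nhds (ENNReal.ofReal (C * (‖h‖ + δ)) + 2 * 0)) :=
      tendsto_const_nhds.add (ENNReal.Tendsto.const_mul hlim (Or.inr (by simp)))
    rw [mul_zero, add_zero] at ht
    refine ge_of_tendsto ht ?_
    filter_upwards [(hφ.comp hψ).tendsto_atTop.eventually (hest δ hδ)] with k hk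
    exact (gg_lim (E (φ (ψ k))) F h).trans (add_le_add (hk h) le_rfl)
  have h2 : Tendsto (fun δ : ℝ => ENNReal.ofReal (C * (‖h‖ + δ))) (nhdsWithin 0 (Ioi 0))
      (nhds (ENNReal.ofReal (C * (‖h‖ + 0)))) := by
    apply Tendsto.mono_left _ nhdsWithin_le_nhds
    have : Continuous (fun δ : ℝ => ENNReal.ofReal (C * (‖h‖ + δ))) :=
      ENNReal.continuous_ofReal.comp (by fun_prop)
    exact this.tendsto 0
  rw [add_zero] at h2
  refine ge_of_tendsto h2 ?_
  filter_upwards [self_mem_nhdsWithin] with δ hδ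
  exact h1 δ hδ

end
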